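/- Let (Ω, ℱ, ℙ) be a probability space, σ > 0, ρ ∈ ℝ, and X : ℕ → Ω → ℝ a process such that almost surely (1/n) ∑_{i=0}^{n−1} X_i(ω)² → σ² and (1/(n−1)) ∑_{i=1}^{n−1} X_i(ω) X_{i−1}(ω) → ρσ² as n → ∞. Then almost surely RoD²(n)(ω) = ν²(n)(ω)/s²(n)(ω) → 2(1 − ρ) as n → ∞. -/

import Mathlib

open MeasureTheory Filter Finset

/-- Expanding the squares of successive differences over `range (n + 1)`. -/
theorem sum_Ico_sub_pred_sq (x : ℕ → ℝ) (n : ℕ) :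
    ∑ i ∈ Ico 1 (n + 1), (x i - x (i - 1)) ^ 2 =
      ∑ i ∈ range (n + 1), x i ^ 2 - x 0 ^ 2 + ∑ i ∈ range n, x i ^ 2
        - 2 * ∑ i ∈ Ico 1 (n + 1), x i * x (i - 1) := by
  induction n with
  | zero => simp
  | succ n ih =>
    rw [sum_Ico_succ_top (show 1 ≤ n + 1 by omega), sum_Ico_succ_top (show 1 ≤ n + 1 by omega), ih,
      sum_range_succ _ (n + 1), sum_range_succ _ n, Nat.add_sub_cancel]
    ring

/-- If the sample mean squares of a real sequence converge to `a` and its sample lag-one moments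
converge to `b`, then its mean squared successive differences converge to `2 * (a - b)`. -/
theorem tendsto_mean_sq_sub_pred {x : ℕ → ℝ} {a b : ℝ}
    (ha : Tendsto (fun n : ℕ => (1 / (n : ℝ)) * ∑ i ∈ range n, x i ^ 2) atTop (nhds a))
    (hb : Tendsto (fun n : ℕ => (1 / ((n : ℝ) - 1)) * ∑ i ∈ Ico 1 n, x i * x (i - 1))
      atTop (nhds b)) :
    Tendsto (fun n : ℕ => (1 / ((n : ℝ) - 1)) * ∑ i ∈ Ico 1 n, (x i - x (i - 1)) ^ 2)
      atTop (nhds (2 * (a - b))) := by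
  rw [← tendsto_add_atTop_iff_nat 1] at hb ⊢
  have ha' := (tendsto_add_atTop_iff_nat 1).2 ha
  have h_inv := tendsto_one_div_atTop_nhds_zero_nat (𝕜 := ℝ)
  have h_lim := ((((h_inv.const_add 1).mul ha').sub (h_inv.mul_const (x 0 ^ 2))).add ha).sub
    (hb.const_mul 2)
  have h_eq : (1 + 0) * a - 0 * x 0 ^ 2 + a - 2 * b = 2 * (a - b) := by ring
  rw [h_eq] at h_lim
  refine h_lim.congr' ?_
  filter_upwards [eventually_gt_atTop 0] with n hn
  have hn' : (n : ℝ) ≠ 0 := by positivity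
  have hn1 : (n : ℝ) + 1 ≠ 0 := by positivity
  rw [sum_Ico_sub_pred_sq]
  push_cast
  rw [add_sub_cancel_right]
  field_simp

/-- Almost-sure version of Proposition 1: if almost surely the sample second moments
converge to `σ²` and the sample lag-1 moments converge to `ρσ²`, then almost surely the
squared ratio of deviations `RoD²(n) = ν²(n)/s²(n)` converges to `2(1 − ρ)`. -/
theorem rod_sq_tendsto_ae {Ω : Type*} [MeasurableSpace Ω] (μ : Measure Ω)
    [IsProbabilityMeasure μ] (X : ℕ → Ω → ℝ) (σ ρ : ℝ) (hσ : 0 < σ)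
    (h1 : ∀ᵐ ω ∂μ, Tendsto (fun n : ℕ => (1 / (n : ℝ)) * ∑ i ∈ range n, (X i ω) ^ 2)
      atTop (nhds (σ ^ 2)))
    (h2 : ∀ᵐ ω ∂μ, Tendsto
      (fun n : ℕ => (1 / ((n : ℝ) - 1)) * ∑ i ∈ Ico 1 n, X i ω * X (i - 1) ω)
      atTop (nhds (ρ * σ ^ 2))) :
    ∀ᵐ ω ∂μ, Tendsto (fun n : ℕ =>
      ((1 / ((n : ℝ) - 1)) * ∑ i ∈ Ico 1 n, (X i ω - X (i - 1) ω) ^ 2) /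
        ((1 / (n : ℝ)) * ∑ i ∈ range n, (X i ω) ^ 2))
      atTop (nhds (2 * (1 - ρ))) := by
  filter_upwards [h1, h2] with ω hω1 hω2
  have hσ2 : σ ^ 2 ≠ 0 := by positivity
  have h_lim := (tendsto_mean_sq_sub_pred hω1 hω2).div hω1 hσ2
  rwa [show 2 * (σ ^ 2 - ρ * σ ^ 2) / σ ^ 2 = 2 * (1 - ρ) by field_simp] at h_lim
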